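/- There is no global-in-time smooth solution of the Wunsch equation with nontrivial mean-zero data. Precisely: there do not exist a smooth function u : [0,∞) × S¹ → ℝ such that (i) for every t, ∫_{S¹} u(t,θ) dθ = 0, (ii) u(0,·) is not identically zero, and (iii) setting ω := H(∂_θ u) (Hilbert transform in the θ variable at each fixed t), the equation ∂_t ω + u ∂_θ ω + 2 (∂_θ u) ω = 0 holds pointwise on [0,∞) × S¹. -/

import Mathlib

open MeasureTheory Real

/-- The `n`-th Fourier coefficient of a `2π`-periodic function `f : ℝ → ℝ`. -/
noncomputable def fourierC (f : ℝ → ℝ) (n : ℤ) : ℂ :=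
  (1 / (2 * π)) * ∫ θ in (0:ℝ)..(2 * π), (f θ : ℂ) * Complex.exp (-Complex.I * (n : ℂ) * (θ : ℂ))

/-- The Hilbert transform on the circle, sending `Σ cₙ e^{inθ}` to `Σ (−i sgn n) cₙ e^{inθ}`. -/
noncomputable def hilbertT (f : ℝ → ℝ) (θ : ℝ) : ℝ :=
  (∑' n : ℤ, -Complex.I * ((n.sign : ℤ) : ℂ) * fourierC f n *
    Complex.exp (Complex.I * (n : ℂ) * (θ : ℂ))).re


namespace WunschAux

/-- Decay of order four. -/
def Dec (C : ℝ) (c : ℕ → ℂ) : Prop := ∀ n : ℕ, ‖c n‖ ≤ C / (n : ℝ) ^ 4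

theorem Dec.zero {C : ℝ} {c : ℕ → ℂ} (h : Dec C c) : c 0 = 0 := by
  have := h 0
  simpa using this

theorem summable_bound (C : ℝ) {j : ℕ} (hj : j ≤ 2) :
    Summable (fun n : ℕ => (n : ℝ) ^ j * (C / (n : ℝ) ^ 4)) := by
  have h2 : Summable (fun n : ℕ => |C| * (1 / (n : ℝ) ^ 2)) :=
    (Real.summable_one_div_nat_pow.mpr (by norm_num)).mul_left _
  refine Summable.of_norm_bounded h2 ?_
  intro n
  rcases Nat.eq_zero_or_pos n with rfl | hn
  · simp
  have hn' : (1 : ℝ) ≤ n := by exact_mod_cast hn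
  rw [norm_mul, norm_div, norm_pow, norm_pow, Real.norm_eq_abs, Real.norm_eq_abs, Nat.abs_cast]
  have : (n : ℝ) ^ j ≤ (n : ℝ) ^ 2 := pow_le_pow_right₀ hn' hj
  calc (n : ℝ) ^ j * (|C| / (n : ℝ) ^ 4) ≤ (n : ℝ) ^ 2 * (|C| / (n : ℝ) ^ 4) := by gcongr
    _ = |C| * (1 / (n : ℝ) ^ 2) := by field_simp

theorem Dec.norm_le {C : ℝ} {c : ℕ → ℂ} (h : Dec C c) (j n : ℕ) :
    ‖(n : ℂ) ^ j * c n‖ ≤ (n : ℝ) ^ j * (C / (n : ℝ) ^ 4) := by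
  rw [norm_mul, norm_pow, Complex.norm_natCast]
  gcongr
  exact h n

theorem Dec.summable {C : ℝ} {c : ℕ → ℂ} (h : Dec C c) {j : ℕ} (hj : j ≤ 2) :
    Summable (fun n : ℕ => ‖(n : ℂ) ^ j * c n‖) :=
  Summable.of_nonneg_of_le (fun _ => norm_nonneg _) (h.norm_le j) (summable_bound C hj)

/-- exponential -/
noncomputable def ex (n : ℤ) (θ : ℝ) : ℂ := Complex.exp (Complex.I * (n : ℂ) * (θ : ℂ))

theorem norm_ex (n : ℤ) (θ : ℝ) : ‖ex n θ‖ = 1 := by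
  have : Complex.I * (n : ℂ) * (θ : ℂ) = ((n * θ : ℝ) : ℂ) * Complex.I := by push_cast; ring
  rw [ex, this, Complex.norm_exp_ofReal_mul_I]

theorem ex_add (m n : ℤ) (θ : ℝ) : ex (m + n) θ = ex m θ * ex n θ := by
  rw [ex, ex, ex, ← Complex.exp_add]; push_cast; ring_nf

theorem conj_ex (n : ℤ) (θ : ℝ) : (starRingEnd ℂ) (ex n θ) = ex (-n) θ := by
  rw [ex, ex, ← Complex.exp_conj]; simp

theorem hasDerivAt_ex (n : ℤ) (θ : ℝ) : HasDerivAt (ex n) (Complex.I * n * ex n θ) θ := by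
  have h1 : HasDerivAt (fun x : ℝ => (x : ℂ)) 1 θ := Complex.ofRealCLM.hasDerivAt
  have h2 := (h1.const_mul (Complex.I * (n : ℂ))).cexp
  convert! h2 using 1
  simp only [ex]; ring

theorem continuous_ex (n : ℤ) : Continuous (ex n) := by
  unfold ex; fun_prop

theorem ex_periodic (n : ℤ) (θ : ℝ) : ex n (θ + 2 * π) = ex n θ := by
  have : Complex.I * (n : ℂ) * ((θ + 2 * π : ℝ) : ℂ)
      = Complex.I * (n : ℂ) * (θ : ℂ) + n * (2 * π * Complex.I) := by push_cast; ring
  rw [ex, ex, this, Complex.exp_add, Complex.exp_int_mul_two_pi_mul_I, mul_one]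

theorem integral_ex (n : ℤ) : ∫ θ in (0:ℝ)..(2 * π), ex n θ = if n = 0 then (2 * π : ℂ) else 0 := by
  split_ifs with h
  · subst h
    simp [ex]
  · have hn : Complex.I * (n : ℂ) ≠ 0 := by simp [h]
    have hd : ∀ x ∈ Set.uIcc (0:ℝ) (2 * π),
        HasDerivAt (fun θ => (Complex.I * (n : ℂ))⁻¹ * ex n θ) (ex n x) x := by
      intro x _
      convert! (hasDerivAt_ex n x).const_mul (Complex.I * (n : ℂ))⁻¹ using 1
      field_simp
    rw [intervalIntegral.integral_eq_sub_of_hasDerivAt hd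
      ((continuous_ex n).intervalIntegrable _ _)]
    have := ex_periodic n 0
    rw [zero_add] at this
    rw [this, sub_self]

theorem integral_series {ι : Type} [Countable ι] (d : ι → ℂ) (e : ι → ℤ)
    (hd : Summable (fun i => ‖d i‖)) :
    ∫ θ in (0:ℝ)..(2 * π), ∑' i, d i * ex (e i) θ
      = ∑' i, d i * (if e i = 0 then (2 * π : ℂ) else 0) := by
  have h := intervalIntegral.hasSum_integral_of_dominated_convergence (μ := volume)
    (a := 0) (b := 2 * π)
    (F := fun i θ => d i * ex (e i) θ) (f := fun θ => ∑' i, d i * ex (e i) θ)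
    (fun i _ => ‖d i‖)
    (fun i => ((continuous_ex (e i)).const_mul (d i)).aestronglyMeasurable)
    (fun i => Filter.Eventually.of_forall fun θ _ => by rw [norm_mul, norm_ex, mul_one])
    (Filter.Eventually.of_forall fun θ _ => hd)
    (by simp)
    (Filter.Eventually.of_forall fun θ _ => by
      apply Summable.hasSum
      apply Summable.of_norm
      simpa [norm_mul, norm_ex] using hd)
  rw [← h.tsum_eq]
  congr 1; ext i
  rw [intervalIntegral.integral_const_mul, integral_ex]

theorem continuous_series {ι : Type} (d : ι → ℂ) (e : ι → ℤ)
    (hd : Summable (fun i => ‖d i‖)) : Continuous (fun θ => ∑' i, d i * ex (e i) θ) := by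
  refine continuous_tsum (fun i => (continuous_ex (e i)).const_mul (d i)) hd ?_
  intro i θ; rw [norm_mul, norm_ex, mul_one]

/-- absolutely convergent Fourier series with positive frequencies -/
def PosF (f : ℝ → ℂ) : Prop := ∃ (ι : Type) (_ : Countable ι) (d : ι → ℂ) (e : ι → ℤ),
  Summable (fun i => ‖d i‖) ∧ (∀ i, d i = 0 ∨ 0 < e i) ∧ ∀ θ, f θ = ∑' i, d i * ex (e i) θ

theorem summable_series {ι : Type} {d : ι → ℂ} {e : ι → ℤ}
    (hd : Summable (fun i => ‖d i‖)) (θ : ℝ) : Summable (fun i => ‖d i * ex (e i) θ‖) := by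
  simpa [norm_mul, norm_ex] using hd

theorem PosF.add {f g : ℝ → ℂ} (hf : PosF f) (hg : PosF g) : PosF (fun θ => f θ + g θ) := by
  obtain ⟨ι, _, d, e, h1, h2, h3⟩ := hf
  obtain ⟨κ, _, d', e', h1', h2', h3'⟩ := hg
  refine ⟨ι ⊕ κ, inferInstance, Sum.elim d d', Sum.elim e e', ?_, ?_, ?_⟩
  · exact (HasSum.sum (f := fun i => ‖Sum.elim d d' i‖) h1.hasSum h1'.hasSum).summable
  · rintro (i | i)
    · exact h2 i
    · exact h2' i
  · intro θ
    beta_reduce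
    rw [h3, h3']
    exact (HasSum.sum (f := fun i => Sum.elim d d' i * ex (Sum.elim e e' i) θ)
      (summable_series h1 θ).of_norm.hasSum (summable_series h1' θ).of_norm.hasSum).tsum_eq.symm

theorem PosF.mul {f g : ℝ → ℂ} (hf : PosF f) (hg : PosF g) : PosF (fun θ => f θ * g θ) := by
  obtain ⟨ι, _, d, e, h1, h2, h3⟩ := hf
  obtain ⟨κ, _, d', e', h1', h2', h3'⟩ := hg
  refine ⟨ι × κ, inferInstance, fun p => d p.1 * d' p.2, fun p => e p.1 + e' p.2, ?_, ?_, ?_⟩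
  · exact Summable.mul_norm h1 h1'
  · rintro ⟨i, j⟩
    rcases h2 i with h | h
    · simp [h]
    rcases h2' j with h' | h'
    · simp [h']
    · right; simp only; omega
  · intro θ
    beta_reduce
    rw [h3, h3', tsum_mul_tsum_of_summable_norm (summable_series h1 θ) (summable_series h1' θ)]
    congr 1; ext p
    rw [ex_add]; ring

theorem PosF.const_mul {f : ℝ → ℂ} (hf : PosF f) (k : ℂ) : PosF (fun θ => k * f θ) := by
  obtain ⟨ι, _, d, e, h1, h2, h3⟩ := hf
  refine ⟨ι, inferInstance, fun p => k * d p, e, ?_, ?_, ?_⟩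
  · simpa [norm_mul] using h1.mul_left ‖k‖
  · intro i
    rcases h2 i with h | h
    · simp [h]
    · exact Or.inr h
  · intro θ
    beta_reduce
    rw [h3, ← tsum_mul_left]
    congr 1; ext p
    ring

theorem PosF.continuous {f : ℝ → ℂ} (hf : PosF f) : Continuous f := by
  obtain ⟨ι, _, d, e, h1, h2, h3⟩ := hf
  rw [show f = _ from funext h3]
  exact continuous_series d e h1

theorem PosF.integral {f : ℝ → ℂ} (hf : PosF f) : ∫ θ in (0:ℝ)..(2 * π), f θ = 0 := by
  obtain ⟨ι, _, d, e, h1, h2, h3⟩ := hf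
  rw [show f = _ from funext h3, integral_series d e h1]
  convert tsum_zero with i
  rcases h2 i with h | h
  · simp [h]
  · simp [h.ne']

theorem PosF.periodic {f : ℝ → ℂ} (hf : PosF f) (θ : ℝ) : f (θ + 2 * π) = f θ := by
  obtain ⟨ι, _, d, e, h1, h2, h3⟩ := hf
  rw [h3, h3]
  simp_rw [ex_periodic]

theorem PosF.eq_zero {f : ℝ → ℂ} (hf : PosF f) (h : ∀ θ, (f θ).re = 0) (θ : ℝ) : f θ = 0 := by
  have h1 := (hf.mul hf).integral
  have hc := hf.continuous
  have h2 : ∀ θ, f θ * f θ = ((-((f θ).im) ^ 2 : ℝ) : ℂ) := by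
    intro θ
    apply Complex.ext
    · rw [Complex.ofReal_re, Complex.mul_re, h θ]; ring
    · rw [Complex.ofReal_im, Complex.mul_im, h θ]; ring
  simp_rw [h2] at h1
  rw [intervalIntegral.integral_ofReal] at h1
  have h3 : ∫ θ in (0:ℝ)..(2 * π), ((f θ).im) ^ 2 = 0 := by
    have : ∫ θ in (0:ℝ)..(2 * π), -((f θ).im) ^ 2 = 0 := by exact_mod_cast h1
    rw [intervalIntegral.integral_neg] at this
    linarith
  have hci : Continuous (fun θ => ((f θ).im) ^ 2) := by fun_prop
  have h4 : ∀ x ∈ Set.Icc (0:ℝ) (2 * π), (f x).im = 0 := by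
    intro x hx
    by_contra hne
    have : 0 < ∫ θ in (0:ℝ)..(2 * π), ((f θ).im) ^ 2 :=
      intervalIntegral.integral_pos (by positivity) hci.continuousOn
        (fun x _ => by positivity) ⟨x, hx, by positivity⟩
    linarith
  have hper : Function.Periodic f (2 * π) := hf.periodic
  obtain ⟨y, hy, hfy⟩ := hper.exists_mem_Ico₀ (by positivity) θ
  rw [hfy]
  exact Complex.ext (h y) (h4 y ⟨hy.1, hy.2.le⟩)



/-! ### algebra with sequences -/

/-- power moments -/
noncomputable def S (j : ℕ) (z : ℕ → ℂ) : ℂ := ∑' n : ℕ, (n : ℂ) ^ j * z n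

/-- the truncated commutator term -/
noncomputable def Y (z : ℕ → ℂ) : ℂ :=
  ∑' p : ℕ × ℕ, ((p.1 ^ 2 - p.2 ^ 2 : ℕ) : ℂ) * (z p.1 * (starRingEnd ℂ) (z p.2))

theorem Dec.conj {C : ℝ} {z : ℕ → ℂ} (h : Dec C z) : Dec C (fun n => (starRingEnd ℂ) (z n)) := by
  intro n; simpa using h n

theorem conj_S (j : ℕ) (z : ℕ → ℂ) :
    (starRingEnd ℂ) (S j z) = S j (fun n => (starRingEnd ℂ) (z n)) := by
  unfold S
  rw [Complex.conj_tsum]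
  simp

theorem S_mul {C D : ℝ} {z w : ℕ → ℂ} (hz : Dec C z) (hw : Dec D w) {i j : ℕ} (hi : i ≤ 2)
    (hj : j ≤ 2) : HasSum (fun p : ℕ × ℕ => ((p.1 : ℂ) ^ i * z p.1) * ((p.2 : ℂ) ^ j * w p.2))
      (S i z * S j w) := by
  unfold S
  rw [tsum_mul_tsum_of_summable_norm (hz.summable hi) (hw.summable hj)]
  exact (Summable.mul_norm (hz.summable hi) (hw.summable hj)).of_norm.hasSum

theorem summable_Y {C : ℝ} {z : ℕ → ℂ} (hz : Dec C z) : Summable (fun p : ℕ × ℕ =>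
    ‖((p.1 ^ 2 - p.2 ^ 2 : ℕ) : ℂ) * (z p.1 * (starRingEnd ℂ) (z p.2))‖) := by
  have := Summable.mul_norm (hz.summable (j := 2) le_rfl) (hz.summable (j := 0) (by norm_num))
  refine Summable.of_nonneg_of_le (fun _ => norm_nonneg _) ?_ this
  rintro ⟨l, k⟩
  simp only [norm_mul, pow_zero, one_mul, Complex.norm_conj, norm_pow, Complex.norm_natCast]
  rw [mul_assoc]
  gcongr
  have : l ^ 2 - k ^ 2 ≤ l ^ 2 := Nat.sub_le _ _
  exact_mod_cast this

theorem alg1 {C : ℝ} {z : ℕ → ℂ} (hz : Dec C z) :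
    S 2 z * (starRingEnd ℂ) (S 0 z) - S 0 z * (starRingEnd ℂ) (S 2 z)
      = Y z - (starRingEnd ℂ) (Y z) := by
  have hY := (summable_Y hz).of_norm.hasSum
  have hY2 : HasSum (fun p : ℕ × ℕ => (starRingEnd ℂ) (((p.2 ^ 2 - p.1 ^ 2 : ℕ) : ℂ) *
      (z p.2 * (starRingEnd ℂ) (z p.1)))) ((starRingEnd ℂ) (Y z)) := by
    have := hY.map (starRingEnd ℂ) Complex.continuous_conj
    exact (Equiv.prodComm ℕ ℕ).hasSum_iff.mpr this
  have h1 := S_mul hz hz.conj (i := 2) (j := 0) le_rfl (by norm_num)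
  have h2 := S_mul hz hz.conj (i := 0) (j := 2) (by norm_num) le_rfl
  rw [conj_S, conj_S]
  refine (h1.sub h2).unique ?_
  convert! hY.sub hY2 using 2 with p
  obtain ⟨l, k⟩ := p
  simp only [map_mul, Complex.conj_natCast, Complex.conj_conj, pow_zero, one_mul]
  rcases le_total (l ^ 2) (k ^ 2) with h | h
  · rw [Nat.sub_eq_zero_of_le h]
    push_cast [Nat.cast_sub h]; ring
  · rw [Nat.sub_eq_zero_of_le h]
    push_cast [Nat.cast_sub h]; ring

theorem alg2 {C : ℝ} {z : ℕ → ℂ} (hz : Dec C z) :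
    HasSum (fun p : ℕ × ℕ => ((min p.1 p.2 ^ 2 : ℕ) : ℂ) * (z p.1 * (starRingEnd ℂ) (z p.2)))
      (S 2 z * (starRingEnd ℂ) (S 0 z) - Y z) := by
  have hY := (summable_Y hz).of_norm.hasSum
  have h1 := S_mul hz hz.conj (i := 2) (j := 0) le_rfl (by norm_num)
  rw [conj_S]
  convert! h1.sub hY using 2 with p
  obtain ⟨l, k⟩ := p
  simp only [pow_zero, one_mul]
  rcases le_total l k with h | h
  · have h' : l ^ 2 ≤ k ^ 2 := Nat.pow_le_pow_left h 2
    rw [Nat.sub_eq_zero_of_le h', min_eq_left h]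
    push_cast; ring
  · have h' : k ^ 2 ≤ l ^ 2 := Nat.pow_le_pow_left h 2
    rw [min_eq_right h]
    push_cast [Nat.cast_sub h']; ring

theorem sum_odd (m : ℕ) : ∑ i ∈ Finset.range m, (2 * i + 1) = m ^ 2 := by
  induction m with
  | zero => simp
  | succ k ih => rw [Finset.sum_range_succ, ih]; ring

/-- tails of finite sums -/
noncomputable def phi (z : ℕ → ℂ) (N m : ℕ) : ℂ := ∑ k ∈ Finset.range N, if m < k then z k else 0

theorem min_sq (N l k : ℕ) (hl : l < N) : (min l k) ^ 2 =
    ∑ m ∈ Finset.range N, (2 * m + 1) * ((if m < l then 1 else 0) * (if m < k then 1 else 0)) := by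
  rw [← sum_odd, ← Finset.sum_subset (s₁ := Finset.range (min l k))
    (s₂ := Finset.range N)]
  · refine Finset.sum_congr rfl fun m hm => ?_
    rw [Finset.mem_range, lt_min_iff] at hm
    simp [hm.1, hm.2]
  · intro m hm
    rw [Finset.mem_range, lt_min_iff] at hm
    rw [Finset.mem_range]; omega
  · intro m _ hm
    rw [Finset.mem_range, lt_min_iff] at hm
    by_cases h : m < l
    · have : ¬ m < k := fun h' => hm ⟨h, h'⟩
      simp [this]
    · simp [h]

theorem finite_Q (z : ℕ → ℂ) (N : ℕ) :
    ∑ p ∈ Finset.range N ×ˢ Finset.range N,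
      ((min p.1 p.2 ^ 2 : ℕ) : ℂ) * (z p.1 * (starRingEnd ℂ) (z p.2))
    = ((∑ m ∈ Finset.range N, (2 * m + 1 : ℝ) * ‖phi z N m‖ ^ 2 : ℝ) : ℂ) := by
  have h1 : ∀ m, ((‖phi z N m‖ ^ 2 : ℝ) : ℂ) = ∑ l ∈ Finset.range N, ∑ k ∈ Finset.range N,
      ((if m < l then 1 else 0) * (if m < k then 1 else 0)) *
        (z l * (starRingEnd ℂ) (z k)) := by
    intro m
    rw [Complex.ofReal_pow, ← Complex.mul_conj', phi, map_sum, Finset.sum_mul_sum]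
    refine Finset.sum_congr rfl fun l _ => Finset.sum_congr rfl fun k _ => ?_
    split_ifs <;> simp
  rw [Finset.sum_product, Complex.ofReal_sum]
  simp_rw [Complex.ofReal_mul, h1, Finset.mul_sum]
  rw [Finset.sum_comm]
  conv_rhs => rw [Finset.sum_comm]
  conv_lhs => rw [Finset.sum_comm]
  refine Finset.sum_congr rfl fun l hl => ?_
  conv_rhs => rw [Finset.sum_comm]
  refine Finset.sum_congr rfl fun k hk => ?_
  rw [min_sq N l k (Finset.mem_range.mp hl)]
  push_cast
  rw [Finset.sum_mul]
  refine Finset.sum_congr rfl fun m _ => ?_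
  ring

theorem phi_diff (z : ℕ → ℂ) (N m : ℕ) (hm : m + 1 < N) :
    z (m + 1) = phi z N m - phi z N (m + 1) := by
  unfold phi
  rw [← Finset.sum_sub_distrib, Finset.sum_eq_single (m + 1)]
  · simp
  · intro b _ hb
    by_cases h : m < b
    · have : m + 1 < b := by omega
      simp [h, this]
    · have : ¬ m + 1 < b := by omega
      simp [h, this]
  · intro h; exact absurd (Finset.mem_range.mpr hm) h

theorem finite_lower (z : ℕ → ℂ) (N : ℕ) :
    ∑ n ∈ Finset.range N, (n : ℝ) * ‖z n‖ ^ 2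
      ≤ 2 * ∑ m ∈ Finset.range N, (2 * m + 1 : ℝ) * ‖phi z N m‖ ^ 2 := by
  rcases N with _ | M
  · simp
  set φ := phi z (M + 1)
  have h1 : ∑ n ∈ Finset.range (M + 1), (n : ℝ) * ‖z n‖ ^ 2
      ≤ ∑ m ∈ Finset.range M, (m + 1 : ℝ) * (2 * ‖φ m‖ ^ 2 + 2 * ‖φ (m + 1)‖ ^ 2) := by
    rw [Finset.sum_range_succ']
    simp only [Nat.cast_zero, zero_mul, add_zero]
    refine Finset.sum_le_sum fun m hm => ?_
    have := Finset.mem_range.mp hm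
    rw [phi_diff z (M + 1) m (by omega)]
    push_cast
    gcongr
    have := norm_sub_le (φ m) (φ (m + 1))
    nlinarith [sq_nonneg (‖φ m‖ - ‖φ (m + 1)‖), norm_nonneg (φ m - φ (m + 1))]
  have h2 : ∑ m ∈ Finset.range M, (m + 1 : ℝ) * ‖φ m‖ ^ 2
      ≤ ∑ m ∈ Finset.range (M + 1), (m + 1 : ℝ) * ‖φ m‖ ^ 2 := by
    rw [Finset.sum_range_succ]
    have : 0 ≤ (M + 1 : ℝ) * ‖φ M‖ ^ 2 := by positivity
    linarith
  have h3 : ∑ m ∈ Finset.range M, (m + 1 : ℝ) * ‖φ (m + 1)‖ ^ 2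
      = ∑ m ∈ Finset.range (M + 1), (m : ℝ) * ‖φ m‖ ^ 2 := by
    rw [Finset.sum_range_succ']; simp
  calc _ ≤ _ := h1
    _ = 2 * ∑ m ∈ Finset.range M, (m + 1 : ℝ) * ‖φ m‖ ^ 2
        + 2 * ∑ m ∈ Finset.range M, (m + 1 : ℝ) * ‖φ (m + 1)‖ ^ 2 := by
        rw [Finset.mul_sum, Finset.mul_sum, ← Finset.sum_add_distrib]
        refine Finset.sum_congr rfl fun m _ => ?_
        ring
    _ ≤ 2 * ∑ m ∈ Finset.range (M + 1), (m + 1 : ℝ) * ‖φ m‖ ^ 2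
        + 2 * ∑ m ∈ Finset.range (M + 1), (m : ℝ) * ‖φ m‖ ^ 2 := by rw [h3]; gcongr
    _ = _ := by
        rw [← mul_add, ← Finset.sum_add_distrib]
        congr 1
        refine Finset.sum_congr rfl fun m _ => ?_
        ring

/-- energy -/
noncomputable def En (z : ℕ → ℂ) : ℝ := ∑' n : ℕ, (n : ℝ) * ‖z n‖ ^ 2

theorem summable_En {C : ℝ} {z : ℕ → ℂ} (hz : Dec C z) :
    Summable (fun n : ℕ => (n : ℝ) * ‖z n‖ ^ 2) := by
  have h := hz.summable (j := 1) (by norm_num)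
  have h0 := hz.summable (j := 0) (by norm_num)
  have h0' : ∀ n, ‖z n‖ ≤ ∑' n : ℕ, ‖(n : ℂ) ^ 0 * z n‖ := by
    intro n
    have := h0.le_tsum n (fun _ _ => norm_nonneg _)
    simpa using this
  refine Summable.of_nonneg_of_le (fun n => by positivity) ?_
    (h.mul_right (∑' n : ℕ, ‖(n : ℂ) ^ 0 * z n‖))
  intro n
  rw [norm_mul, pow_one, Complex.norm_natCast, sq, mul_assoc]
  gcongr
  exact h0' n

theorem alg3 {C : ℝ} {z : ℕ → ℂ} (hz : Dec C z) :
    ∃ r : ℝ, S 2 z * (starRingEnd ℂ) (S 0 z) - Y z = (r : ℂ) ∧ En z ≤ 2 * r := by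
  set Q := S 2 z * (starRingEnd ℂ) (S 0 z) - Y z with hQ
  have h := alg2 hz
  have ht : Filter.Tendsto (fun N : ℕ => Finset.range N ×ˢ Finset.range N) Filter.atTop
      Filter.atTop := by
    have h1 : Filter.Tendsto (fun N : ℕ => (Finset.range N, Finset.range N)) Filter.atTop
        Filter.atTop := by
      rw [← Filter.prod_atTop_atTop_eq]
      exact Filter.tendsto_finset_range.prodMk Filter.tendsto_finset_range
    exact Filter.tendsto_finsetProd_atTop.comp h1
  have h2 := Filter.Tendsto.comp (show Filter.Tendsto _ _ _ from h) ht
  have h3 : Filter.Tendsto (fun N : ℕ =>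
      ((∑ m ∈ Finset.range N, (2 * m + 1 : ℝ) * ‖phi z N m‖ ^ 2 : ℝ) : ℂ)) Filter.atTop
      (nhds Q) := by
    refine h2.congr fun N => ?_
    exact finite_Q z N
  have him := (Complex.continuous_im.tendsto Q).comp h3
  have hre := (Complex.continuous_re.tendsto Q).comp h3
  have him0 : Q.im = 0 := by
    refine tendsto_nhds_unique him ?_
    simp only [Function.comp_def, Complex.ofReal_im]
    exact tendsto_const_nhds
  refine ⟨Q.re, Complex.ext (by simp) (by simp [him0]), ?_⟩
  refine le_of_tendsto_of_tendsto (summable_En hz).hasSum.tendsto_sum_nat (hre.const_mul 2)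
    (Filter.Eventually.of_forall fun N => ?_)
  simp only [Function.comp_def, Complex.ofReal_re]
  exact finite_lower z N



/-! ### twisted sequences -/

/-- the sequence of terms of the Fourier series at the point `θ` -/
noncomputable def tw (c : ℕ → ℂ) (θ : ℝ) : ℕ → ℂ := fun n => c n * ex n θ

theorem Dec.tw {C : ℝ} {c : ℕ → ℂ} (h : Dec C c) (θ : ℝ) : Dec C (tw c θ) := by
  intro n
  rw [WunschAux.tw, norm_mul, norm_ex, mul_one]
  exact h n

theorem En_tw (c : ℕ → ℂ) (θ : ℝ) : En (tw c θ) = En c := by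
  unfold En tw
  simp [norm_ex]

theorem norm_S_le {C : ℝ} {c : ℕ → ℂ} (h : Dec C c) {j : ℕ} (hj : j ≤ 2) :
    ‖S j c‖ ≤ ∑' n : ℕ, (n : ℝ) ^ j * (C / (n : ℝ) ^ 4) :=
  tsum_of_norm_bounded (summable_bound C hj).hasSum (h.norm_le j)

theorem posF_S {C : ℝ} {c : ℕ → ℂ} (h : Dec C c) {j : ℕ} (hj : j ≤ 2) :
    PosF (fun θ => S j (tw c θ)) := by
  refine ⟨ℕ, inferInstance, fun n => (n : ℂ) ^ j * c n, fun n => (n : ℤ), h.summable hj, ?_, ?_⟩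
  · intro n
    rcases Nat.eq_zero_or_pos n with rfl | hn
    · left; simp [h.zero]
    · right; show (0 : ℤ) < (n : ℤ); exact_mod_cast hn
  · intro θ
    simp only [S, tw]
    congr 1; ext n; ring

theorem posF_Y {C : ℝ} {c : ℕ → ℂ} (h : Dec C c) : PosF (fun θ => Y (tw c θ)) := by
  refine ⟨ℕ × ℕ, inferInstance,
    fun p => ((p.1 ^ 2 - p.2 ^ 2 : ℕ) : ℂ) * (c p.1 * (starRingEnd ℂ) (c p.2)),
    fun p => (p.1 : ℤ) + (-(p.2 : ℤ)), summable_Y h, ?_, ?_⟩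
  · rintro ⟨l, k⟩
    rcases le_or_gt l k with hlk | hlk
    · left
      have : l ^ 2 ≤ k ^ 2 := Nat.pow_le_pow_left hlk 2
      simp [Nat.sub_eq_zero_of_le this]
    · right; simp only; omega
  · intro θ
    simp only [Y, tw]
    congr 1; ext p
    rw [ex_add, ← conj_ex, map_mul]; ring

theorem hasDerivAt_S {C : ℝ} {c c' : ℝ → ℕ → ℂ} {γ g : ℝ → ℝ} {s : Set ℝ} {G : ℝ}
    (hs : IsOpen s) (hs' : IsPreconnected s)
    (hd : ∀ t ∈ s, ∀ n, HasDerivAt (fun r => c r n) (c' t n) t)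
    (hc : ∀ t ∈ s, Dec C (c t)) (hc' : ∀ t ∈ s, Dec C (c' t))
    (hγ : ∀ t ∈ s, HasDerivAt γ (g t) t) (hG : ∀ t ∈ s, |g t| ≤ G)
    {j : ℕ} (hj : j ≤ 1) {t : ℝ} (ht : t ∈ s) :
    HasDerivAt (fun r => S j (tw (c r) (γ r)))
      (S j (tw (c' t) (γ t)) + g t * (Complex.I * S (j + 1) (tw (c t) (γ t)))) t := by
  have key := hasDerivAt_tsum_of_isPreconnected (𝕜 := ℝ)
    (u := fun n : ℕ => (n : ℝ) ^ j * (C / (n : ℝ) ^ 4)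
      + G * ((n : ℝ) ^ (j + 1) * (C / (n : ℝ) ^ 4)))
    (g := fun (n : ℕ) r => (n : ℂ) ^ j * tw (c r) (γ r) n)
    (g' := fun (n : ℕ) r => (n : ℂ) ^ j * tw (c' r) (γ r) n
      + (g r : ℂ) * Complex.I * ((n : ℂ) ^ (j + 1) * tw (c r) (γ r) n))
    ((summable_bound C (by omega)).add ((summable_bound C (by omega)).mul_left G)) hs hs'
    ?_ ?_ ht ((hc t ht).tw _ |>.summable (by omega)).of_norm ht
  · convert! key using 1
    have h1 := ((hc' t ht).tw (γ t)).summable (j := j) (by omega)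
    have h2 := ((hc t ht).tw (γ t)).summable (j := j + 1) (by omega)
    rw [Summable.tsum_add h1.of_norm (h2.of_norm.mul_left _), tsum_mul_left]
    simp only [S]
    ring
  · intro n r hr
    have h1 : HasDerivAt (fun r => ex n (γ r)) (g r • (Complex.I * (n : ℤ) * ex n (γ r))) r :=
      (hasDerivAt_ex n (γ r)).scomp r (hγ r hr)
    have h2 := ((hd r hr n).mul h1).const_mul ((n : ℂ) ^ j)
    convert! h2 using 1
    simp only [tw, Complex.real_smul, Int.cast_natCast]
    ring
  · intro n r hr
    have h1 := ((hc' r hr).tw (γ r)).norm_le j n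
    have h2 := ((hc r hr).tw (γ r)).norm_le (j + 1) n
    refine (norm_add_le _ _).trans (add_le_add h1 ?_)
    rw [norm_mul, norm_mul, Complex.norm_I, mul_one, Complex.norm_real]
    have hG0 : 0 ≤ G := (abs_nonneg _).trans (hG r hr)
    exact mul_le_mul (hG r hr) h2 (norm_nonneg _) hG0

theorem hasDerivAt_S_space {C : ℝ} {c : ℕ → ℂ} (hc : Dec C c) {j : ℕ} (hj : j ≤ 1) (θ : ℝ) :
    HasDerivAt (fun x => S j (tw c x)) (Complex.I * S (j + 1) (tw c θ)) θ := by
  have hz : Dec |C| (fun _ => 0) := by intro n; simp; positivity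
  have hc2 : Dec |C| c := fun n => (hc n).trans (by gcongr; exact le_abs_self C)
  have := hasDerivAt_S (c := fun _ => c) (c' := fun _ _ => 0) (γ := fun x => x) (g := fun _ => 1)
    (s := Set.univ) (C := |C|) (G := 1) isOpen_univ isPreconnected_univ
    (fun t _ n => hasDerivAt_const t (c n)) (fun _ _ => hc2) (fun _ _ => hz)
    (fun t _ => hasDerivAt_id t) (by simp) hj (Set.mem_univ θ)
  convert! this using 1
  simp [S, tw]

/-- The Wunsch equation at a fixed time, in Fourier form. `b` are the coefficients of `u_t`. -/
def Eqn (b c : ℕ → ℂ) : Prop := ∀ θ : ℝ,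
  2 * (S 1 (tw b θ)).re + (2 * (S 0 (tw c θ)).re) * (2 * (Complex.I * S 2 (tw c θ)).re)
    + 2 * (2 * (Complex.I * S 1 (tw c θ)).re) * (2 * (S 1 (tw c θ)).re) = 0

theorem Eqn.proj {C D : ℝ} {b c : ℕ → ℂ} (hb : Dec D b) (hc : Dec C c) (h : Eqn b c) (θ : ℝ) :
    S 1 (tw b θ) + Complex.I * (S 0 (tw c θ) * S 2 (tw c θ) + 2 * (S 1 (tw c θ) * S 1 (tw c θ))
      + Y (tw c θ)) = 0 := by
  have hp0 := posF_S hc (j := 0) (by norm_num)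
  have hp1 := posF_S hc (j := 1) (by norm_num)
  have hp2 := posF_S hc (j := 2) (by norm_num)
  have hK := (posF_S hb (j := 1) (by norm_num)).add
    ((((hp0.mul hp2).add ((hp1.mul hp1).const_mul 2)).add (posF_Y hc)).const_mul Complex.I)
  refine hK.eq_zero (fun x => ?_) θ
  have h1 := h x
  have h2 := congrArg Complex.im (alg1 (hc.tw x))
  simp only [Complex.add_re, Complex.mul_re, Complex.I_re, Complex.I_im, Complex.sub_im,
    Complex.mul_im, Complex.conj_re, Complex.conj_im, Complex.add_im, Complex.re_ofNat,
    Complex.im_ofNat] at h1 h2 ⊢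
  linarith

theorem Eqn.energy {C D : ℝ} {b c : ℕ → ℂ} (hb : Dec D b) (hc : Dec C c) (h : Eqn b c) :
    (∑' n : ℕ, (n : ℂ) * b n * (starRingEnd ℂ) (c n)).re = 0 := by
  -- the integral of `B₁ conj A`
  have hsum := Summable.mul_norm (hb.summable (j := 1) (by norm_num))
    (hc.conj.summable (j := 0) (by norm_num))
  have hser : ∀ θ, S 1 (tw b θ) * (starRingEnd ℂ) (S 0 (tw c θ)) = ∑' p : ℕ × ℕ,
      ((p.1 : ℂ) ^ 1 * b p.1 * ((p.2 : ℂ) ^ 0 * (starRingEnd ℂ) (c p.2)))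
        * ex ((p.1 : ℤ) + (-(p.2 : ℤ))) θ := by
    intro θ
    rw [conj_S, ← (S_mul (hb.tw θ) (hc.tw θ).conj (i := 1) (j := 0) (by norm_num)
      (by norm_num)).tsum_eq]
    congr 1; ext p
    rw [ex_add, ← conj_ex]
    simp only [tw, map_mul]
    ring
  have hI1 : ∫ θ in (0:ℝ)..(2 * π), S 1 (tw b θ) * (starRingEnd ℂ) (S 0 (tw c θ))
      = (∑' n : ℕ, (n : ℂ) * b n * (starRingEnd ℂ) (c n)) * (2 * π) := by
    simp_rw [hser]
    rw [integral_series _ _ hsum, ← tsum_mul_right]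
    have hinj : Function.Injective (fun n : ℕ => (n, n)) := fun a b h => (Prod.mk.inj h).1
    rw [← hinj.tsum_eq]
    · congr 1; ext n
      simp
    · rintro ⟨l, k⟩ hlk
      rw [Function.mem_support] at hlk
      by_cases h : l = k
      · exact ⟨l, by simp [h]⟩
      · exfalso; apply hlk
        have : ¬ ((l : ℤ) + (-(k : ℤ)) = 0) := by omega
        simp only [this, if_false, mul_zero]
  have hI2 := ((posF_S hb (j := 1) (by norm_num)).mul (posF_S hc (j := 0) (by norm_num))).integral
  have cB := (posF_S hb (j := 1) (by norm_num)).continuous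
  have cA0 := (posF_S hc (j := 0) (by norm_num)).continuous
  have cA1 := (posF_S hc (j := 1) (by norm_num)).continuous
  have cA2 := (posF_S hc (j := 2) (by norm_num)).continuous
  -- total derivative
  have hder : ∀ θ ∈ Set.uIcc (0:ℝ) (2 * π), HasDerivAt
      (fun x => -((2 * (S 0 (tw c x)).re) ^ 2 * (2 * (S 1 (tw c x)).re)))
      ((2 * (S 1 (tw b θ)).re) * (2 * (S 0 (tw c θ)).re)) θ := by
    intro θ _
    have d0 := (Complex.reCLM.hasFDerivAt.comp_hasDerivAt θ
      (hasDerivAt_S_space hc (j := 0) (by norm_num) θ)).const_mul 2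
    have d1 := (Complex.reCLM.hasFDerivAt.comp_hasDerivAt θ
      (hasDerivAt_S_space hc (j := 1) (by norm_num) θ)).const_mul 2
    have d2 := ((d0.pow 2).mul d1).neg
    convert! d2 using 1
    have h1 := h θ
    simp only [Complex.reCLM_apply, Function.comp_apply, zero_add, Nat.reduceAdd, Pi.pow_apply] at h1 ⊢
    push_cast
    linear_combination (2 * (S 0 (tw c θ)).re) * h1
  have hI3 := intervalIntegral.integral_eq_sub_of_hasDerivAt hder
    (Continuous.intervalIntegrable (by fun_prop) _ _)
  have p0 := (posF_S hc (j := 0) (by norm_num)).periodic 0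
  have p1 := (posF_S hc (j := 1) (by norm_num)).periodic 0
  rw [zero_add] at p0 p1
  rw [p0, p1, sub_self] at hI3
  have hsplit : ∀ θ, (2 * (S 1 (tw b θ)).re) * (2 * (S 0 (tw c θ)).re)
      = Complex.reCLM (2 * (S 1 (tw b θ) * (starRingEnd ℂ) (S 0 (tw c θ))
        + S 1 (tw b θ) * S 0 (tw c θ))) := by
    intro θ
    simp only [Complex.reCLM_apply, Complex.add_re, Complex.mul_re, Complex.add_im,
      Complex.mul_im, Complex.conj_re, Complex.conj_im, Complex.re_ofNat, Complex.im_ofNat]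
    ring
  simp_rw [hsplit] at hI3
  have ci1 : Continuous (fun θ => S 1 (tw b θ) * (starRingEnd ℂ) (S 0 (tw c θ))) :=
    cB.mul (Complex.continuous_conj.comp cA0)
  have ci2 : Continuous (fun θ => S 1 (tw b θ) * S 0 (tw c θ)) := cB.mul cA0
  have ci3 : Continuous (fun θ => (2 : ℂ) * (S 1 (tw b θ) * (starRingEnd ℂ) (S 0 (tw c θ))
        + S 1 (tw b θ) * S 0 (tw c θ))) := continuous_const.mul (ci1.add ci2)
  rw [ContinuousLinearMap.intervalIntegral_comp_comm _ (ci3.intervalIntegrable _ _),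
    intervalIntegral.integral_const_mul, intervalIntegral.integral_add
    (ci1.intervalIntegrable _ _) (ci2.intervalIntegrable _ _), hI2, hI1] at hI3
  simp only [Complex.reCLM_apply, add_zero] at hI3
  rw [show (2 : ℂ) * ((∑' n : ℕ, (n : ℂ) * b n * (starRingEnd ℂ) (c n)) * (2 * π))
    = ((4 * π : ℝ) : ℂ) * (∑' n : ℕ, (n : ℂ) * b n * (starRingEnd ℂ) (c n)) by push_cast; ring,
    Complex.re_ofReal_mul] at hI3
  have : (4 * π : ℝ) ≠ 0 := by positivity
  exact (mul_eq_zero.mp hI3).resolve_left this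



theorem hasDerivAt_En {C : ℝ} {c c' : ℝ → ℕ → ℂ} {s : Set ℝ}
    (hs : IsOpen s) (hs' : IsPreconnected s)
    (hd : ∀ t ∈ s, ∀ n, HasDerivAt (fun r => c r n) (c' t n) t)
    (hc : ∀ t ∈ s, Dec C (c t)) (hc' : ∀ t ∈ s, Dec C (c' t))
    (he : ∀ t ∈ s, Eqn (c' t) (c t)) {t : ℝ} (ht : t ∈ s) :
    HasDerivAt (fun r => En (c r)) 0 t := by
  have hC0 : 0 ≤ C := by
    have := (norm_nonneg _).trans (hc t ht 1)
    simpa using this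
  have hCn : ∀ n : ℕ, C / (n : ℝ) ^ 4 ≤ C := by
    intro n
    rcases Nat.eq_zero_or_pos n with rfl | hn
    · simpa using hC0
    · apply div_le_self hC0
      apply one_le_pow₀
      exact_mod_cast hn
  have hbound : ∀ (n : ℕ), ∀ r ∈ s, ‖(n : ℂ) * c' r n * (starRingEnd ℂ) (c r n)‖
      ≤ (n : ℝ) ^ 1 * (C / (n : ℝ) ^ 4) * C := by
    intro n r hr
    rw [norm_mul, Complex.norm_conj]
    have h1 := (hc' r hr).norm_le 1 n
    rw [pow_one] at h1
    exact mul_le_mul h1 ((hc r hr n).trans (hCn n)) (norm_nonneg _) ((norm_nonneg _).trans h1)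
  have hsb := (summable_bound C (j := 1) (by norm_num)).mul_right C
  have key := hasDerivAt_tsum_of_isPreconnected (𝕜 := ℝ)
    (u := fun n : ℕ => 2 * ((n : ℝ) ^ 1 * (C / (n : ℝ) ^ 4) * C))
    (g := fun (n : ℕ) r => (n : ℝ) * ‖c r n‖ ^ 2)
    (g' := fun (n : ℕ) r => 2 * ((n : ℂ) * c' r n * (starRingEnd ℂ) (c r n)).re)
    (hsb.mul_left 2) hs hs' ?_ ?_ ht (summable_En (hc t ht)) ht
  · convert! key using 1
    rw [tsum_mul_left, ← Complex.re_tsum, (he t ht).energy (hc' t ht) (hc t ht), mul_zero]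
    exact Summable.of_norm_bounded hsb (fun n => hbound n t ht)
  · intro n r hr
    convert! ((hd r hr n).norm_sq).const_mul (n : ℝ) using 1
    rw [Complex.inner, show (n : ℂ) * c' r n * (starRingEnd ℂ) (c r n)
      = ((n : ℝ) : ℂ) * ((starRingEnd ℂ) (c r n) * c' r n) by push_cast; ring,
      Complex.re_ofReal_mul]
    ring_nf
  · intro n r hr
    rw [norm_mul, Real.norm_ofNat]
    gcongr
    exact (Complex.abs_re_le_norm _).trans (hbound n r hr)

theorem hasDerivAt_W {C : ℝ} {c c' : ℝ → ℕ → ℂ} {γ : ℝ → ℝ} {s : Set ℝ}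
    (hs : IsOpen s) (hs' : IsPreconnected s)
    (hd : ∀ t ∈ s, ∀ n, HasDerivAt (fun r => c r n) (c' t n) t)
    (hc : ∀ t ∈ s, Dec C (c t)) (hc' : ∀ t ∈ s, Dec C (c' t))
    (he : ∀ t ∈ s, Eqn (c' t) (c t))
    (hγ : ∀ t ∈ s, HasDerivAt γ (2 * (S 0 (tw (c t) (γ t))).re) t) {t : ℝ} (ht : t ∈ s) :
    ∃ F : ℝ, En (c t) ≤ F ∧ HasDerivAt (fun r => 2 * Complex.I * S 1 (tw (c r) (γ r)))
      (-(2 * Complex.I * S 1 (tw (c t) (γ t))) ^ 2 - F) t := by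
  obtain ⟨r, hr, hr'⟩ := alg3 ((hc t ht).tw (γ t))
  rw [En_tw] at hr'
  refine ⟨2 * r, hr', ?_⟩
  have h1 := (hasDerivAt_S (G := 2 * ∑' n : ℕ, (n : ℝ) ^ 0 * (C / (n : ℝ) ^ 4))
    hs hs' hd hc hc' hγ ?_ (j := 1) le_rfl ht).const_mul (2 * Complex.I)
  · convert! h1 using 1
    have hp := (he t ht).proj (hc' t ht) (hc t ht) (γ t)
    set A0 := S 0 (tw (c t) (γ t))
    set A1 := S 1 (tw (c t) (γ t))
    set A2 := S 2 (tw (c t) (γ t))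
    have hre : ((2 * A0.re : ℝ) : ℂ) = A0 + (starRingEnd ℂ) A0 := by
      rw [Complex.add_conj]
    rw [hre]
    have hI : Complex.I ^ 2 = -1 := Complex.I_sq
    push_cast
    rw [← hr]
    linear_combination (-2 * Complex.I) * hp + (2 * Y (tw (c t) (γ t)) - 2 * A2 * (starRingEnd ℂ) A0) * hI
  · intro x hx
    rw [abs_mul, abs_two]
    gcongr
    exact (Complex.abs_re_le_norm _).trans (norm_S_le ((hc x hx).tw _) (by norm_num))

theorem exists_zero {C : ℝ} {c : ℕ → ℂ} (hc : Dec C c) : ∃ θ, (S 1 (tw c θ)).re = 0 := by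
  have hd : ∀ θ, HasDerivAt (fun x => (S 0 (tw c x)).im) ((S 1 (tw c θ)).re) θ := by
    intro θ
    have := (Complex.imCLM.hasFDerivAt.comp_hasDerivAt θ
      (hasDerivAt_S_space hc (j := 0) (by norm_num) θ))
    convert! this using 1
    simp
  have p0 := (posF_S hc (j := 0) (by norm_num)).periodic 0
  rw [zero_add] at p0
  obtain ⟨x, _, hx⟩ := exists_hasDerivAt_eq_zero (a := 0) (b := 2 * π) (by positivity)
    (f := fun x => (S 0 (tw c x)).im) (f' := fun x => (S 1 (tw c x)).re)
    (fun x _ => (hd x).continuousAt.continuousWithinAt) (by rw [p0])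
    (fun x _ => hd x)
  exact ⟨x, hx⟩

theorem exists_flow {C : ℝ} {c c' : ℝ → ℕ → ℂ} {s : Set ℝ}
    (hs : IsOpen s) (hs' : IsPreconnected s)
    (hd : ∀ t ∈ s, ∀ n, HasDerivAt (fun r => c r n) (c' t n) t)
    (hc : ∀ t ∈ s, Dec C (c t)) (hc' : ∀ t ∈ s, Dec C (c' t)) {a b t₁ x₀ : ℝ}
    (hab : Set.Icc a b ⊆ s) (ht₁ : t₁ ∈ Set.Icc a b) :
    ∃ γ : ℝ → ℝ, γ t₁ = x₀ ∧
      ∀ t ∈ Set.Ioo a b, HasDerivAt γ (2 * (S 0 (tw (c t) (γ t))).re) t := by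
  have hC0 : 0 ≤ C := by
    have := (norm_nonneg _).trans (hc t₁ (hab ht₁) 1)
    simpa using this
  have hL0 : ∀ j : ℕ, 0 ≤ 2 * ∑' n : ℕ, (n : ℝ) ^ j * (C / (n : ℝ) ^ 4) := by
    intro j
    have : 0 ≤ ∑' n : ℕ, (n : ℝ) ^ j * (C / (n : ℝ) ^ 4) := tsum_nonneg fun n => by positivity
    linarith
  set L : NNReal := ⟨_, hL0 0⟩ with hL
  set K : NNReal := ⟨_, hL0 1⟩ with hK
  have hdS : ∀ t ∈ s, ∀ x, HasDerivAt (fun x => 2 * (S 0 (tw (c t) x)).re)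
      (2 * (Complex.I * S 1 (tw (c t) x)).re) x := by
    intro t ht x
    exact (Complex.reCLM.hasFDerivAt.comp_hasDerivAt x
      (hasDerivAt_S_space (hc t ht) (j := 0) (by norm_num) x)).const_mul 2
  have hm0 : 0 ≤ max (b - t₁) (t₁ - a) := le_max_of_le_left (by linarith [ht₁.2])
  obtain ⟨M, hM⟩ : ∃ M : NNReal, (M : ℝ) = max (b - t₁) (t₁ - a) := ⟨⟨_, hm0⟩, rfl⟩
  have hPL : IsPicardLindelof (fun t x => 2 * (S 0 (tw (c t) x)).re) (⟨t₁, ht₁⟩ : Set.Icc a b) x₀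
      (L * M) 0 L K := by
    constructor
    · intro t ht
      apply LipschitzWith.lipschitzOnWith
      apply lipschitzWith_of_nnnorm_deriv_le (fun x => (hdS t (hab ht) x).differentiableAt)
      intro x
      rw [(hdS t (hab ht) x).deriv, ← NNReal.coe_le_coe, coe_nnnorm, norm_mul, Real.norm_ofNat]
      refine mul_le_mul_of_nonneg_left ?_ (by norm_num)
      refine (Complex.abs_re_le_norm _).trans ?_
      rw [norm_mul, Complex.norm_I, one_mul]
      exact norm_S_le ((hc t (hab ht)).tw _) (by norm_num)
    · intro x _ t ht
      have := hasDerivAt_S hs hs' hd hc hc' (γ := fun _ => x) (g := fun _ => 0) (G := 0)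
        (fun t _ => hasDerivAt_const t x) (by simp) (j := 0) (by norm_num) (hab ht)
      have h2 := this.continuousAt
      exact (continuousAt_const.mul (Complex.continuous_re.continuousAt.comp h2)).continuousWithinAt
    · intro t ht x _
      rw [norm_mul, Real.norm_ofNat]
      refine mul_le_mul_of_nonneg_left ?_ (by norm_num)
      exact (Complex.abs_re_le_norm _).trans (norm_S_le ((hc t (hab ht)).tw _) (by norm_num))
    · simp only [NNReal.coe_zero, sub_zero]
      rw [NNReal.coe_mul, hM]
  obtain ⟨γ, h1, h2⟩ := hPL.exists_eq_forall_mem_Icc_hasDerivWithinAt₀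
  refine ⟨γ, h1, fun t ht => ?_⟩
  exact (h2 t ⟨ht.1.le, ht.2.le⟩).hasDerivAt (Icc_mem_nhds ht.1 ht.2)



theorem riccati {q F : ℝ → ℝ} {E t₁ T : ℝ} (hE : 0 < E) (hT : t₁ + 4 / √E ≤ T)
    (hq : ∀ t ∈ Set.Icc t₁ T, HasDerivAt q (-(q t) ^ 2 - F t) t)
    (hF : ∀ t ∈ Set.Icc t₁ T, E ≤ F t) : False := by
  have hsE : 0 < √E := Real.sqrt_pos.mpr hE
  have hsq : √E ^ 2 = E := Real.sq_sqrt hE.le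
  have h0 : 0 < 4 / √E := by positivity
  have hd : ∀ t ∈ Set.Icc t₁ T, HasDerivAt (fun t => Real.arctan (q t / √E))
      (1 / (1 + (q t / √E) ^ 2) * ((-(q t) ^ 2 - F t) / √E)) t := by
    intro t ht
    exact ((hq t ht).div_const _).arctan
  have hb : ∀ t ∈ Set.Icc t₁ T,
      1 / (1 + (q t / √E) ^ 2) * ((-(q t) ^ 2 - F t) / √E) ≤ -√E := by
    intro t ht
    have h1 : 1 + (q t / √E) ^ 2 = (E + q t ^ 2) / E := by
      rw [div_pow, hsq]; field_simp
    rw [h1, one_div_div, div_mul_div_comm, div_le_iff₀ (by positivity)]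
    have := hF t ht
    have : E * (-(q t) ^ 2 - F t) ≤ E * (-(q t) ^ 2 - E) := by
      apply mul_le_mul_of_nonneg_left _ hE.le; linarith
    calc _ ≤ _ := this
      _ = -√E ^ 2 * (E + q t ^ 2) := by rw [hsq]; ring
      _ = _ := by ring
  have key := Convex.image_sub_le_mul_sub_of_deriv_le (convex_Icc t₁ T)
    (f := fun t => Real.arctan (q t / √E)) (C := -√E)
    (fun t ht => (hd t ht).continuousAt.continuousWithinAt)
    (fun t ht => (hd t (interior_subset ht)).differentiableAt.differentiableWithinAt)
    (fun t ht => by rw [(hd t (interior_subset ht)).deriv]; exact hb t (interior_subset ht))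
    t₁ ⟨le_rfl, by linarith⟩ T ⟨by linarith, le_rfl⟩ (by linarith)
  have h1 := Real.neg_pi_div_two_lt_arctan (q T / √E)
  have h2 := Real.arctan_lt_pi_div_two (q t₁ / √E)
  have h3 : 4 ≤ √E * (T - t₁) := by
    calc (4 : ℝ) = √E * (4 / √E) := by field_simp
      _ ≤ _ := by gcongr; linarith
  have h4 := Real.pi_lt_four
  linarith

theorem core {c c' : ℝ → ℕ → ℂ}
    (hd : ∀ t, 0 < t → ∀ n, HasDerivAt (fun r => c r n) (c' t n) t)
    (hdec : ∀ a b, 0 < a → ∃ C, ∀ t ∈ Set.Icc a b, Dec C (c t) ∧ Dec C (c' t))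
    (he : ∀ t, 0 < t → Eqn (c' t) (c t))
    {t₁ : ℝ} (ht₁ : 0 < t₁) (hE : 0 < En (c t₁)) : False := by
  set E := En (c t₁) with hEdef
  have h4 : 0 < 4 / √E := by positivity
  obtain ⟨T, hT⟩ : ∃ T, T = t₁ + 4 / √E := ⟨_, rfl⟩
  obtain ⟨C, hC⟩ := hdec (t₁ / 4) (T + 2) (by positivity)
  have hs : ∀ t ∈ Set.Ioo (t₁ / 4) (T + 2), 0 < t := fun t ht => by
    have := ht.1; linarith
  have hCs : ∀ t ∈ Set.Ioo (t₁ / 4) (T + 2), Dec C (c t) ∧ Dec C (c' t) :=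
    fun t ht => hC t ⟨ht.1.le, ht.2.le⟩
  obtain ⟨x₀, hx₀⟩ := exists_zero (hCs t₁ ⟨by linarith, by linarith⟩).1
  obtain ⟨γ, hγ0, hγ⟩ := exists_flow (x₀ := x₀) isOpen_Ioo isPreconnected_Ioo
    (fun t ht => hd t (hs t ht)) (fun t ht => (hCs t ht).1) (fun t ht => (hCs t ht).2)
    (a := t₁ / 2) (b := T + 1) (t₁ := t₁)
    (fun t ht => ⟨by linarith [ht.1], by linarith [ht.2]⟩) ⟨by linarith, by linarith⟩
  have hsub : Set.Ioo (t₁ / 2) (T + 1) ⊆ Set.Ioo (t₁ / 4) (T + 2) :=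
    fun t ht => ⟨by linarith [ht.1], by linarith [ht.2]⟩
  have hsub2 : Set.Icc t₁ T ⊆ Set.Ioo (t₁ / 2) (T + 1) :=
    fun t ht => ⟨by linarith [ht.1], by linarith [ht.2]⟩
  have hEn : ∀ t ∈ Set.Icc t₁ T, En (c t) = E := by
    have hd0 : ∀ t ∈ Set.Icc t₁ T, HasDerivAt (fun r => En (c r)) 0 t := fun t ht =>
      hasDerivAt_En isOpen_Ioo isPreconnected_Ioo (fun t ht => hd t (hs t ht))
        (fun t ht => (hCs t ht).1) (fun t ht => (hCs t ht).2) (fun t ht => he t (hs t ht))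
        (hsub (hsub2 ht))
    exact constant_of_has_deriv_right_zero (f := fun r => En (c r))
      (fun t ht => (hd0 t ht).continuousAt.continuousWithinAt)
      (fun t ht => (hd0 t ⟨ht.1, ht.2.le⟩).hasDerivWithinAt)
  set W : ℝ → ℂ := fun r => 2 * Complex.I * S 1 (tw (c r) (γ r)) with hW
  have hWd : ∀ t ∈ Set.Icc t₁ T, ∃ F : ℝ, E ≤ F ∧ HasDerivAt W (-(W t) ^ 2 - F) t := by
    intro t ht
    rw [← hEn t ht]
    exact hasDerivAt_W isOpen_Ioo isPreconnected_Ioo (fun t ht => hd t (hs t (hsub ht)))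
        (fun t ht => (hCs t (hsub ht)).1) (fun t ht => (hCs t (hsub ht)).2)
        (fun t ht => he t (hs t (hsub ht))) hγ (hsub2 ht)
  choose! F hF1 hF2 using hWd
  have hre : ∀ t ∈ Set.Icc t₁ T, HasDerivAt (fun r => (W r).re)
      (-((W t).re) ^ 2 + ((W t).im) ^ 2 - F t) t := by
    intro t ht
    have := Complex.reCLM.hasFDerivAt.comp_hasDerivAt t (hF2 t ht)
    convert! this using 1
    simp [sq]
    ring
  have him : ∀ t ∈ Set.Icc t₁ T, HasDerivAt (fun r => (W r).im)
      (-(2 * (W t).re * (W t).im)) t := by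
    intro t ht
    have := Complex.imCLM.hasFDerivAt.comp_hasDerivAt t (hF2 t ht)
    convert! this using 1
    simp [sq]
    ring
  have hWb : ∀ t ∈ Set.Icc t₁ T, ‖W t‖ ≤ 2 * ∑' n : ℕ, (n : ℝ) ^ 1 * (C / (n : ℝ) ^ 4) := by
    intro t ht
    rw [hW]
    simp only [norm_mul, Complex.norm_I, Complex.norm_ofNat, mul_one]
    gcongr
    exact norm_S_le ((hCs t (hsub (hsub2 ht))).1.tw _) (by norm_num)
  have him0 : ∀ t ∈ Set.Icc t₁ T, (W t).im = 0 := by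
    refine eq_zero_of_abs_deriv_le_mul_abs_self_of_eq_zero_right (f := fun r => (W r).im)
      (f' := fun t => -(2 * (W t).re * (W t).im))
      (K := 2 * (2 * ∑' n : ℕ, (n : ℝ) ^ 1 * (C / (n : ℝ) ^ 4)))
      (fun t ht => (him t ht).continuousAt.continuousWithinAt)
      (fun t ht => (him t ⟨ht.1, ht.2.le⟩).hasDerivWithinAt) ?_ ?_
    · simp [hW, hγ0, hx₀]
    · intro t ht
      rw [norm_neg, norm_mul, norm_mul, Real.norm_ofNat]
      gcongr
      exact (Complex.abs_re_le_norm _).trans (hWb t ⟨ht.1, ht.2.le⟩)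
  refine riccati (q := fun t => (W t).re) (F := F) hE hT.symm.le (fun t ht => ?_) hF1
  convert! hre t ht using 1
  rw [him0 t ht]; ring



/-! ### from the function to its coefficients -/

/-- smoothness for positive times -/
def Sm (g : ℝ → ℝ → ℝ) : Prop :=
  ContDiffOn ℝ ((⊤ : ℕ∞) : WithTop ℕ∞) (fun p : ℝ × ℝ => g p.1 p.2)
    (Set.Ioi (0 : ℝ) ×ˢ (Set.univ : Set ℝ))

theorem isOpen_dom : IsOpen (Set.Ioi (0 : ℝ) ×ˢ (Set.univ : Set ℝ)) := isOpen_Ioi.prod isOpen_univ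

theorem Sm.hasFDerivAt {g : ℝ → ℝ → ℝ} (h : Sm g) {t : ℝ} (ht : 0 < t) (θ : ℝ) :
    HasFDerivAt (fun p : ℝ × ℝ => g p.1 p.2)
      (fderiv ℝ (fun p : ℝ × ℝ => g p.1 p.2) (t, θ)) (t, θ) := by
  have : (t, θ) ∈ (Set.Ioi (0 : ℝ) ×ˢ (Set.univ : Set ℝ)) := ⟨ht, trivial⟩
  exact ((h.contDiffAt (isOpen_dom.mem_nhds this)).differentiableAt (by simp)).hasFDerivAt

theorem Sm.dx' {g : ℝ → ℝ → ℝ} (h : Sm g) {t : ℝ} (ht : 0 < t) (θ : ℝ) :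
    HasDerivAt (g t) (fderiv ℝ (fun p : ℝ × ℝ => g p.1 p.2) (t, θ) (0, 1)) θ := by
  have h1 : HasDerivAt (fun x : ℝ => (t, x)) ((0 : ℝ), (1 : ℝ)) θ :=
    (hasDerivAt_const θ t).prodMk (hasDerivAt_id θ)
  exact (h.hasFDerivAt ht θ).comp_hasDerivAt θ h1

theorem Sm.dt' {g : ℝ → ℝ → ℝ} (h : Sm g) {t : ℝ} (ht : 0 < t) (θ : ℝ) :
    HasDerivAt (fun s => g s θ) (fderiv ℝ (fun p : ℝ × ℝ => g p.1 p.2) (t, θ) (1, 0)) t := by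
  have h1 : HasDerivAt (fun x : ℝ => (x, θ)) ((1 : ℝ), (0 : ℝ)) t :=
    (hasDerivAt_id t).prodMk (hasDerivAt_const t θ)
  exact (h.hasFDerivAt ht θ).comp_hasDerivAt t h1

theorem Sm.fd {g : ℝ → ℝ → ℝ} (h : Sm g) (v : ℝ × ℝ) :
    ContDiffOn ℝ ((⊤ : ℕ∞) : WithTop ℕ∞)
      (fun p : ℝ × ℝ => fderiv ℝ (fun p : ℝ × ℝ => g p.1 p.2) p v)
      (Set.Ioi (0 : ℝ) ×ˢ (Set.univ : Set ℝ)) :=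
  (ContDiffOn.fderiv_of_isOpen h isOpen_dom (by simp)).clm_apply contDiffOn_const

/-- space derivative -/
noncomputable def Dx (g : ℝ → ℝ → ℝ) : ℝ → ℝ → ℝ := fun t => deriv (g t)

/-- time derivative -/
noncomputable def Dt (g : ℝ → ℝ → ℝ) : ℝ → ℝ → ℝ := fun t θ => deriv (fun s => g s θ) t

theorem Sm.dx {g : ℝ → ℝ → ℝ} (h : Sm g) : Sm (Dx g) := by
  refine (h.fd (0, 1)).congr ?_
  rintro ⟨t, θ⟩ ⟨ht, _⟩
  exact (h.dx' ht θ).deriv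

theorem Sm.dt {g : ℝ → ℝ → ℝ} (h : Sm g) : Sm (Dt g) := by
  refine (h.fd (1, 0)).congr ?_
  rintro ⟨t, θ⟩ ⟨ht, _⟩
  exact (h.dt' ht θ).deriv

theorem Sm.hasDerivAt_x {g : ℝ → ℝ → ℝ} (h : Sm g) {t : ℝ} (ht : 0 < t) (θ : ℝ) :
    HasDerivAt (g t) (Dx g t θ) θ := (h.dx' ht θ).differentiableAt.hasDerivAt

theorem Sm.hasDerivAt_t {g : ℝ → ℝ → ℝ} (h : Sm g) {t : ℝ} (ht : 0 < t) (θ : ℝ) :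
    HasDerivAt (fun s => g s θ) (Dt g t θ) t := (h.dt' ht θ).differentiableAt.hasDerivAt

theorem Sm.continuous {g : ℝ → ℝ → ℝ} (h : Sm g) {t : ℝ} (ht : 0 < t) : Continuous (g t) :=
  continuous_iff_continuousAt.mpr fun θ => (h.hasDerivAt_x ht θ).continuousAt

/-- periodicity for positive times -/
def Per (g : ℝ → ℝ → ℝ) : Prop := ∀ t, 0 < t → ∀ θ, g t (θ + 2 * π) = g t θ

theorem Per.dx {g : ℝ → ℝ → ℝ} (h : Per g) : Per (Dx g) := by
  intro t ht θ
  unfold Dx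
  rw [← deriv_comp_add_const]
  congr 1
  ext x
  exact h t ht x

theorem Per.dt {g : ℝ → ℝ → ℝ} (h : Per g) : Per (Dt g) := by
  intro t ht θ
  unfold Dt
  apply Filter.EventuallyEq.deriv_eq
  filter_upwards [Ioi_mem_nhds ht] with s hs
  exact h s hs θ

theorem fourierC_eq (f : ℝ → ℝ) (n : ℤ) :
    fourierC f n = (1 / (2 * π)) * ∫ θ in (0:ℝ)..(2 * π), (f θ : ℂ) * ex (-n) θ := by
  unfold fourierC ex
  congr 3
  ext θ
  congr 2
  push_cast; ring

theorem fourierC_deriv {f f' : ℝ → ℝ} (hf : ∀ θ, HasDerivAt f (f' θ) θ) (hf' : Continuous f')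
    (hp : f (2 * π) = f 0) (n : ℤ) : fourierC f' n = Complex.I * n * fourierC f n := by
  rw [fourierC_eq, fourierC_eq]
  have h := intervalIntegral.integral_mul_deriv_eq_deriv_mul (a := 0) (b := 2 * π)
    (u := ex (-n)) (u' := fun θ => Complex.I * ((-n : ℤ) : ℂ) * ex (-n) θ)
    (v := fun θ => (f θ : ℂ)) (v' := fun θ => (f' θ : ℂ))
    (fun x _ => hasDerivAt_ex (-n) x) (fun x _ => (hf x).ofReal_comp)
    ((continuous_const.mul (continuous_ex _)).intervalIntegrable _ _)
    ((Complex.continuous_ofReal.comp hf').intervalIntegrable _ _)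
  have he := ex_periodic (-n) 0
  rw [zero_add] at he
  rw [he, hp, sub_self, zero_sub] at h
  have h2 : ∫ θ in (0:ℝ)..(2 * π), (f' θ : ℂ) * ex (-n) θ
      = Complex.I * n * ∫ θ in (0:ℝ)..(2 * π), (f θ : ℂ) * ex (-n) θ := by
    rw [← intervalIntegral.integral_const_mul]
    simp_rw [mul_comm ((f' _ : ℝ) : ℂ)]
    rw [h, ← intervalIntegral.integral_neg]
    congr 1; ext θ
    push_cast; ring
  rw [h2]; ring

theorem fourierC_dx {g : ℝ → ℝ → ℝ} (h : Sm g) (hp : Per g) {t : ℝ} (ht : 0 < t) (n : ℤ) :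
    fourierC (Dx g t) n = Complex.I * n * fourierC (g t) n := by
  refine fourierC_deriv (h.hasDerivAt_x ht) (h.dx.continuous ht) ?_ n
  have := hp t ht 0
  rwa [zero_add] at this

theorem exists_bound {g : ℝ → ℝ → ℝ} (h : Sm g) {a b : ℝ} (ha : 0 < a) :
    ∃ C, 0 ≤ C ∧ ∀ t ∈ Set.Icc a b, ∀ θ ∈ Set.Icc (0 : ℝ) (2 * π), ‖g t θ‖ ≤ C := by
  have hK : IsCompact (Set.Icc a b ×ˢ Set.Icc (0 : ℝ) (2 * π)) := isCompact_Icc.prod isCompact_Icc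
  have hc : ContinuousOn (fun p : ℝ × ℝ => g p.1 p.2)
      (Set.Icc a b ×ˢ Set.Icc (0 : ℝ) (2 * π)) :=
    h.continuousOn.mono fun p hp => ⟨lt_of_lt_of_le ha hp.1.1, trivial⟩
  obtain ⟨C, hC⟩ := hK.exists_bound_of_continuousOn hc
  refine ⟨max C 0, le_max_right _ _, fun t ht θ hθ => ?_⟩
  exact (hC (t, θ) ⟨ht, hθ⟩).trans (le_max_left _ _)

theorem norm_fourierC_le {f : ℝ → ℝ} {C : ℝ} (h : ∀ θ ∈ Set.Icc (0 : ℝ) (2 * π), ‖f θ‖ ≤ C)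
    (n : ℤ) : ‖fourierC f n‖ ≤ C := by
  have hpi : 0 < 2 * π := by positivity
  rw [fourierC_eq, norm_mul]
  have h1 := intervalIntegral.norm_integral_le_of_norm_le_const (a := 0) (b := 2 * π) (C := C)
    (f := fun θ => (f θ : ℂ) * ex (-n) θ) (fun x hx => by
      rw [Set.uIoc_of_le hpi.le] at hx
      rw [norm_mul, norm_ex, mul_one, Complex.norm_real]
      exact h x ⟨hx.1.le, hx.2⟩)
  rw [sub_zero, abs_of_pos hpi] at h1
  have h2 : ‖(1 / (2 * π) : ℂ)‖ = 1 / (2 * π) := by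
    rw [show (1 / (2 * π) : ℂ) = ((1 / (2 * π) : ℝ) : ℂ) by push_cast; ring, Complex.norm_real,
      Real.norm_of_nonneg (by positivity)]
  rw [h2]
  calc 1 / (2 * π) * ‖∫ θ in (0:ℝ)..(2 * π), (f θ : ℂ) * ex (-n) θ‖
      ≤ 1 / (2 * π) * (C * (2 * π)) := by gcongr
    _ = C := by field_simp

theorem exists_dec {g : ℝ → ℝ → ℝ} (h : Sm g) (hp : Per g) {a b : ℝ} (ha : 0 < a)  :
    ∃ C, 0 ≤ C ∧ ∀ t ∈ Set.Icc a b, ∀ n : ℕ, n ≠ 0 → ‖fourierC (g t) n‖ ≤ C / (n : ℝ) ^ 4 := by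
  obtain ⟨C, hC0, hC⟩ := exists_bound h.dx.dx.dx.dx (b := b) ha
  refine ⟨C, hC0, fun t ht n hn => ?_⟩
  have ht0 : 0 < t := lt_of_lt_of_le ha ht.1
  have h1 := norm_fourierC_le (hC t ht) n
  rw [fourierC_dx h.dx.dx.dx hp.dx.dx.dx ht0, fourierC_dx h.dx.dx hp.dx.dx ht0,
    fourierC_dx h.dx hp.dx ht0, fourierC_dx h hp ht0] at h1
  simp only [norm_mul, Complex.norm_I, one_mul, Int.cast_natCast, Complex.norm_natCast] at h1
  have hn' : (0 : ℝ) < n := by exact_mod_cast Nat.pos_of_ne_zero hn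
  rw [le_div_iff₀ (by positivity)]
  calc _ = _ := by ring
    _ ≤ C := h1

theorem hasDerivAt_fourierC {g : ℝ → ℝ → ℝ} (h : Sm g) {t : ℝ} (ht : 0 < t) (n : ℤ) :
    HasDerivAt (fun s => fourierC (g s) n) (fourierC (Dt g t) n) t := by
  simp_rw [fourierC_eq]
  apply HasDerivAt.const_mul
  obtain ⟨C, hC0, hC⟩ := exists_bound h.dt (a := t / 2) (b := t + 1) (by positivity)
  have hpi : 0 < 2 * π := by positivity
  have hs : Set.Icc (t / 2) (t + 1) ∈ nhds t := Icc_mem_nhds (by linarith) (by linarith)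
  refine (intervalIntegral.hasDerivAt_integral_of_dominated_loc_of_deriv_le (μ := volume)
    (a := 0) (b := 2 * π)
    (F := fun s θ => (g s θ : ℂ) * ex (-n) θ) (F' := fun s θ => (Dt g s θ : ℂ) * ex (-n) θ)
    (bound := fun _ => C) hs ?_ ?_ ?_ ?_ ?_ ?_).2
  · filter_upwards [Ioi_mem_nhds ht] with s hs
    exact ((Complex.continuous_ofReal.comp (h.continuous hs)).mul
      (continuous_ex _)).aestronglyMeasurable
  · exact ((Complex.continuous_ofReal.comp (h.continuous ht)).mul
      (continuous_ex _)).intervalIntegrable _ _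
  · exact ((Complex.continuous_ofReal.comp (h.dt.continuous ht)).mul
      (continuous_ex _)).aestronglyMeasurable
  · refine Filter.Eventually.of_forall fun x hx s hs => ?_
    rw [Set.uIoc_of_le hpi.le] at hx
    rw [norm_mul, norm_ex, mul_one, Complex.norm_real]
    exact hC s hs x ⟨hx.1.le, hx.2⟩
  · exact intervalIntegrable_const
  · refine Filter.Eventually.of_forall fun x hx s hs => ?_
    have hs0 : 0 < s := by have := hs.1; linarith
    exact ((h.hasDerivAt_t hs0 x).ofReal_comp).mul_const _

theorem fourierC_neg (f : ℝ → ℝ) (n : ℤ) :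
    fourierC f (-n) = (starRingEnd ℂ) (fourierC f n) := by
  rw [fourierC_eq, fourierC_eq, map_mul]
  congr 1
  · have h2 : (1 / (2 * π) : ℂ) = ((1 / (2 * π) : ℝ) : ℂ) := by push_cast; ring
    rw [h2, Complex.conj_ofReal]
  · have : ∀ θ : ℝ, (f θ : ℂ) * ex (- -n) θ = (starRingEnd ℂ) ((f θ : ℂ) * ex (-n) θ) := by
      intro θ
      rw [map_mul, conj_ex, Complex.conj_ofReal]
    simp_rw [this]
    simp only [intervalIntegral, map_sub, integral_conj]



theorem hasSum_two_sided {d : ℤ → ℂ} {z : ℕ → ℂ} (hz : Summable z) (hz0 : z 0 = 0)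
    (h1 : ∀ n : ℕ, d n = z n) (h2 : ∀ n : ℕ, d (-(n : ℤ)) = (starRingEnd ℂ) (z n)) :
    HasSum d ((2 * (∑' n, z n).re : ℝ) : ℂ) := by
  have a1 : HasSum (fun n : ℕ => d n) (∑' n, z n) := by
    simp_rw [h1]; exact hz.hasSum
  have a2 : HasSum (fun n : ℕ => d (-(n : ℤ))) ((starRingEnd ℂ) (∑' n, z n)) := by
    simp_rw [h2]; exact Complex.hasSum_conj'.mpr hz.hasSum
  have h := HasSum.of_nat_of_neg a1 a2
  have h0 : d 0 = 0 := by simpa [hz0] using h1 0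
  convert! h using 1
  rw [h0, sub_zero, Complex.add_conj]

theorem inversion {f : ℝ → ℝ} (hf : Continuous f) (hp : ∀ θ, f (θ + 2 * π) = f θ)
    {C : ℝ} (hd : Dec C (fun n : ℕ => fourierC f n)) (θ : ℝ) :
    f θ = 2 * (S 0 (tw (fun n : ℕ => fourierC f n) θ)).re := by
  have : Fact (0 < 2 * π) := ⟨by positivity⟩
  let F : ℝ → ℂ := fun x => (f x : ℂ)
  have hF : Function.Periodic F (2 * π) := fun x => by simp [F, hp]
  have hFc : Continuous F := Complex.continuous_ofReal.comp hf
  let G : C(AddCircle (2 * π), ℂ) :=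
    ⟨hF.lift, continuous_coinduced_dom.mpr hFc⟩
  have hG : ∀ x : ℝ, G (x : AddCircle (2 * π)) = (f x : ℂ) := fun x => rfl
  have hco : ∀ n : ℤ, fourierCoeff G n = fourierC f n := by
    intro n
    rw [fourierCoeff_eq_intervalIntegral _ n 0, fourierC_eq, zero_add]
    rw [Complex.real_smul]
    congr 1
    · push_cast; ring
    · congr 1
      ext x
      rw [hG, smul_eq_mul, mul_comm]
      congr 1
      rw [fourier_coe_apply, ex]
      congr 1
      have : (π : ℂ) ≠ 0 := by exact_mod_cast Real.pi_ne_zero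
      push_cast
      field_simp
  have hsum := (hd.tw θ).summable (j := 0) (by norm_num)
  have hz0 : ((0 : ℕ) : ℂ) ^ 0 * tw (fun n : ℕ => fourierC f n) θ 0 = 0 := by
    rw [(hd.tw θ).zero, mul_zero]
  have two : HasSum (fun n : ℤ => fourierC f n * ex n θ) _ :=
    hasSum_two_sided (z := fun n : ℕ => (n : ℂ) ^ 0 * tw (fun n : ℕ => fourierC f n) θ n)
    hsum.of_norm hz0 (fun n => by simp [tw]) (fun n => by
      rw [fourierC_neg, ← conj_ex]; simp [tw])
  have hs2 : Summable (fourierCoeff G) := by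
    have := two.summable.norm
    simp only [norm_mul, norm_ex, mul_one] at this
    rw [show fourierCoeff G = fun n => fourierC f n from funext hco]
    exact this.of_norm
  have h3 := has_pointwise_sum_fourier_series_of_summable hs2 (θ : AddCircle (2 * π))
  have h4 : ∀ n : ℤ, fourierCoeff G n • fourier n (θ : AddCircle (2 * π))
      = fourierC f n * ex n θ := by
    intro n
    rw [hco, smul_eq_mul, fourier_coe_apply, ex]
    congr 2
    have : (π : ℂ) ≠ 0 := by exact_mod_cast Real.pi_ne_zero
    push_cast
    field_simp
  simp_rw [h4] at h3
  have h5 := h3.unique two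
  rw [hG] at h5
  exact Complex.ofReal_injective h5

theorem hilbert_eq {f g : ℝ → ℝ} (hg : ∀ n : ℤ, fourierC g n = Complex.I * n * fourierC f n)
    {C : ℝ} (hd : Dec C (fun n : ℕ => fourierC f n)) (θ : ℝ) :
    hilbertT g θ = 2 * (S 1 (tw (fun n : ℕ => fourierC f n) θ)).re := by
  have hsum := (hd.tw θ).summable (j := 1) (by norm_num)
  have hz0 : ((0 : ℕ) : ℂ) ^ 1 * tw (fun n : ℕ => fourierC f n) θ 0 = 0 := by
    rw [(hd.tw θ).zero, mul_zero]
  have hI : Complex.I * Complex.I = -1 := Complex.I_mul_I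
  have hsg : ∀ n : ℕ, ((((n : ℤ).sign : ℤ) : ℂ)) * (n : ℂ) = n := by
    intro n
    rcases Nat.eq_zero_or_pos n with h | h
    · simp [h]
    · rw [Int.sign_eq_one_of_pos (by exact_mod_cast h)]; simp
  have two : HasSum (fun n : ℤ => -Complex.I * ((n.sign : ℤ) : ℂ) * fourierC g n *
    Complex.exp (Complex.I * (n : ℂ) * (θ : ℂ))) _ :=
    hasSum_two_sided (z := fun n : ℕ => (n : ℂ) ^ 1 * tw (fun n : ℕ => fourierC f n) θ n)
    hsum.of_norm hz0 (fun n => by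
      rw [hg]
      change _ * ex n θ = (n : ℂ) ^ 1 * (fourierC f n * ex n θ)
      push_cast
      linear_combination (-(((n : ℤ).sign : ℤ) : ℂ) * n * fourierC f n * ex n θ) * hI
        + fourierC f n * ex n θ * hsg n) (fun n => by
      rw [hg, fourierC_neg]
      change _ * ex (-(n : ℤ)) θ = (starRingEnd ℂ) ((n : ℂ) ^ 1 * (fourierC f n * ex n θ))
      rw [map_mul, map_mul, conj_ex, map_pow, Complex.conj_natCast, Int.sign_neg]
      push_cast
      linear_combination (-(((n : ℤ).sign : ℤ) : ℂ) * n * (starRingEnd ℂ) (fourierC f n)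
          * ex (-(n : ℤ)) θ) * hI
        + (starRingEnd ℂ) (fourierC f n) * ex (-(n : ℤ)) θ * hsg n)
  unfold hilbertT
  rw [two.tsum_eq, Complex.ofReal_re]
  rfl

theorem fourierC_zero {f : ℝ → ℝ} (h : ∫ θ in (0:ℝ)..(2 * π), f θ = 0) : fourierC f 0 = 0 := by
  rw [fourierC_eq]
  have : ∀ θ : ℝ, (f θ : ℂ) * ex (-0) θ = (f θ : ℂ) := by intro θ; simp [ex]
  simp_rw [this]
  rw [intervalIntegral.integral_ofReal, h]; simp

theorem final (u : ℝ → ℝ → ℝ)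
    (h1 : ContDiffOn ℝ (⊤ : ℕ∞) (fun p : ℝ × ℝ => u p.1 p.2) (Set.Ici (0:ℝ) ×ˢ Set.univ))
    (h2 : ∀ t ∈ Set.Ici (0:ℝ), ∀ θ : ℝ, u t (θ + 2 * π) = u t θ)
    (h3 : ∀ t ∈ Set.Ici (0:ℝ), (∫ θ in (0:ℝ)..(2 * π), u t θ) = 0)
    (h4 : ∃ θ : ℝ, u 0 θ ≠ 0)
    (h5 : ∀ t ∈ Set.Ici (0:ℝ), ∀ θ : ℝ,
        derivWithin (fun s => hilbertT (deriv (u s)) θ) (Set.Ici (0:ℝ)) t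
          + u t θ * deriv (fun x => hilbertT (deriv (u t)) x) θ
          + 2 * deriv (u t) θ * hilbertT (deriv (u t)) θ = 0) : False := by
  have hS : Sm u := h1.mono (Set.prod_mono Set.Ioi_subset_Ici_self subset_rfl)
  have hP : Per u := fun t ht θ => h2 t ht.le θ
  obtain ⟨c, hc⟩ : ∃ c : ℝ → ℕ → ℂ, c = fun t (n : ℕ) => fourierC (u t) n := ⟨_, rfl⟩
  obtain ⟨c', hc'⟩ : ∃ c' : ℝ → ℕ → ℂ, c' = fun t (n : ℕ) => fourierC (Dt u t) n := ⟨_, rfl⟩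
  have hct : ∀ t, c t = fun n : ℕ => fourierC (u t) n := fun t => by rw [hc]
  have hd : ∀ t, 0 < t → ∀ n, HasDerivAt (fun r => c r n) (c' t n) t := by
    intro t ht n
    rw [hc, hc']
    exact hasDerivAt_fourierC hS ht n
  have hc0 : ∀ t, 0 < t → c t 0 = 0 := by
    intro t ht
    rw [hc]
    exact fourierC_zero (h3 t ht.le)
  have hc0' : ∀ t, 0 < t → c' t 0 = 0 := by
    intro t ht
    have e : (fun r => c r 0) =ᶠ[nhds t] fun _ => (0 : ℂ) := by
      filter_upwards [Ioi_mem_nhds ht] with s hs using hc0 s hs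
    exact (hd t ht 0).unique ((hasDerivAt_const t (0 : ℂ)).congr_of_eventuallyEq e)
  have hdec : ∀ a b, 0 < a → ∃ C, ∀ t ∈ Set.Icc a b, Dec C (c t) ∧ Dec C (c' t) := by
    intro a b ha
    obtain ⟨C, hC0, hC⟩ := exists_dec hS hP (b := b) ha
    obtain ⟨D, hD0, hD⟩ := exists_dec hS.dt hP.dt (b := b) ha
    refine ⟨C + D, fun t ht => ⟨fun n => ?_, fun n => ?_⟩⟩
    · rcases eq_or_ne n 0 with rfl | hn
      · rw [hc0 t (lt_of_lt_of_le ha ht.1)]; simp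
      · rw [hc]
        refine (hC t ht n hn).trans ?_
        gcongr; linarith
    · rcases eq_or_ne n 0 with rfl | hn
      · rw [hc0' t (lt_of_lt_of_le ha ht.1)]; simp
      · rw [hc']
        refine (hD t ht n hn).trans ?_
        gcongr; linarith
  have hdec1 : ∀ t, 0 < t → ∃ C, Dec C (c t) := by
    intro t ht
    obtain ⟨C, hC⟩ := hdec t t ht
    exact ⟨C, (hC t ⟨le_rfl, le_rfl⟩).1⟩
  have hinv : ∀ t, 0 < t → ∀ θ, u t θ = 2 * (S 0 (tw (c t) θ)).re := by
    intro t ht θ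
    obtain ⟨C, hC⟩ := hdec1 t ht
    rw [hct] at hC ⊢
    exact inversion (hS.continuous ht) (hP t ht) hC θ
  have hhil : ∀ t, 0 < t → ∀ θ, hilbertT (deriv (u t)) θ = 2 * (S 1 (tw (c t) θ)).re := by
    intro t ht θ
    obtain ⟨C, hC⟩ := hdec1 t ht
    rw [hct] at hC ⊢
    exact hilbert_eq (fun n => fourierC_dx hS hP ht n) hC θ
  have hre : ∀ {F : ℝ → ℂ} {F' : ℂ} {x : ℝ}, HasDerivAt F F' x →
      HasDerivAt (fun y => 2 * (F y).re) (2 * F'.re) x := by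
    intro F F' x h
    exact ((Complex.reCLM.hasFDerivAt.comp_hasDerivAt x h)).const_mul 2
  have he : ∀ t, 0 < t → Eqn (c' t) (c t) := by
    intro t ht θ
    obtain ⟨C, hC⟩ := hdec1 t ht
    have e1 : deriv (u t) θ = 2 * (Complex.I * S 1 (tw (c t) θ)).re := by
      rw [show u t = fun y => 2 * (S 0 (tw (c t) y)).re from funext (hinv t ht)]
      exact (hre (hasDerivAt_S_space hC (j := 0) (by norm_num) θ)).deriv
    have e2 : deriv (fun x => hilbertT (deriv (u t)) x) θ
        = 2 * (Complex.I * S 2 (tw (c t) θ)).re := by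
      rw [show (fun x => hilbertT (deriv (u t)) x) = fun y => 2 * (S 1 (tw (c t) y)).re from
        funext (hhil t ht)]
      exact (hre (hasDerivAt_S_space hC (j := 1) (by norm_num) θ)).deriv
    have e3 : derivWithin (fun s => hilbertT (deriv (u s)) θ) (Set.Ici (0:ℝ)) t
        = 2 * (S 1 (tw (c' t) θ)).re := by
      rw [derivWithin_of_mem_nhds (Ici_mem_nhds ht)]
      have e : (fun s => hilbertT (deriv (u s)) θ) =ᶠ[nhds t]
          fun s => 2 * (S 1 (tw (c s) θ)).re := by
        filter_upwards [Ioi_mem_nhds ht] with s hs using hhil s hs θ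
      rw [e.deriv_eq]
      obtain ⟨D, hD⟩ := hdec (t / 2) (t + 1) (by positivity)
      have hpos : ∀ r ∈ Set.Ioo (t / 2) (t + 1), 0 < r := fun r hr => by
        have := hr.1; linarith
      have k := hasDerivAt_S (c := c) (c' := c') (γ := fun _ => θ) (g := fun _ => 0)
        (s := Set.Ioo (t / 2) (t + 1)) (C := D) (G := 0) isOpen_Ioo isPreconnected_Ioo
        (fun r hr n => hd r (hpos r hr) n) (fun r hr => (hD r ⟨hr.1.le, hr.2.le⟩).1)
        (fun r hr => (hD r ⟨hr.1.le, hr.2.le⟩).2) (fun r _ => hasDerivAt_const r θ) (by simp)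
        (j := 1) le_rfl (t := t) ⟨by linarith, by linarith⟩
      rw [(hre k).deriv]
      simp
    have := h5 t ht.le θ
    rw [e1, e2, e3, hinv t ht, hhil t ht] at this
    exact this
  obtain ⟨θ, hθ⟩ := h4
  have hcont : ContinuousWithinAt (fun s => u s θ) (Set.Ici 0) 0 := by
    have a := h1.continuousOn (0, θ) ⟨Set.self_mem_Ici, trivial⟩
    have b : ContinuousWithinAt (fun s : ℝ => (s, θ)) (Set.Ici 0) 0 := by fun_prop
    exact ContinuousWithinAt.comp (t := Set.Ici (0:ℝ) ×ˢ Set.univ) (f := fun s : ℝ => (s, θ))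
      a b (fun s hs => ⟨hs, trivial⟩)
  have hev : ∀ᶠ s in nhdsWithin (0 : ℝ) (Set.Ioi 0), u s θ ≠ 0 :=
    (hcont.mono Set.Ioi_subset_Ici_self).eventually_ne hθ
  obtain ⟨t₁, hut, ht₁⟩ := (hev.and self_mem_nhdsWithin).exists
  have ht₁ : 0 < t₁ := ht₁
  obtain ⟨C, hC⟩ := hdec1 t₁ ht₁
  have hE : 0 < En (c t₁) := by
    have hne : ∃ n, c t₁ n ≠ 0 := by
      by_contra! hall
      apply hut
      rw [hinv t₁ ht₁]
      simp [S, tw, hall]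
    obtain ⟨n, hn⟩ := hne
    have hn0 : n ≠ 0 := by
      rintro rfl
      exact hn (hc0 t₁ ht₁)
    refine (summable_En hC).tsum_pos (fun i => by positivity) n ?_
    have : 0 < n := Nat.pos_of_ne_zero hn0
    positivity
  exact core hd hdec he ht₁ hE

end WunschAux

/-- There is no global-in-time smooth solution of the Wunsch equation
`ω_t + u ω_θ + 2 u_θ ω = 0`, `ω = H(u_θ)`, on `[0,∞) × S¹` with nontrivial mean-zero data. -/
theorem no_global_smooth_wunsch_solution :
    ¬ ∃ u : ℝ → ℝ → ℝ,
      -- `u` is smooth on `[0,∞) × S¹`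
      ContDiffOn ℝ (⊤ : ℕ∞) (fun p : ℝ × ℝ => u p.1 p.2) (Set.Ici (0:ℝ) ×ˢ Set.univ) ∧
      -- `u(t,·)` is a function on the circle `S¹ = ℝ/2πℤ`
      (∀ t ∈ Set.Ici (0:ℝ), ∀ θ : ℝ, u t (θ + 2 * π) = u t θ) ∧
      -- (i) mean zero for every `t ≥ 0`
      (∀ t ∈ Set.Ici (0:ℝ), (∫ θ in (0:ℝ)..(2 * π), u t θ) = 0) ∧
      -- (ii) `u(0,·)` is not identically zero
      (∃ θ : ℝ, u 0 θ ≠ 0) ∧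
      -- (iii) the Wunsch equation holds pointwise on `[0,∞) × S¹`, with `ω = H(∂_θ u)`
      (∀ t ∈ Set.Ici (0:ℝ), ∀ θ : ℝ,
        derivWithin (fun s => hilbertT (deriv (u s)) θ) (Set.Ici (0:ℝ)) t
          + u t θ * deriv (fun x => hilbertT (deriv (u t)) x) θ
          + 2 * deriv (u t) θ * hilbertT (deriv (u t)) θ = 0) := by
  rintro ⟨u, h1, h2, h3, h4, h5⟩
  exact WunschAux.final u h1 h2 h3 h4 h5
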